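/- Let α ∈ (0,2) with α ≠ 1 and λ ≥ 0. There exists a constant C > 0, independent of h, ξ and λ, such that for every h > 0 and every real ξ with |ξ| ≤ π/h, |S_λ^α(ξ) − S_{λ,h}^α(ξ)| ≤ C·α·(λ² + ξ²)^{(α+4)/2}·h⁴. -/

import Mathlib

open Complex

/-- Discrete symbol of the fourth-order (p = 4) central finite difference
approximation of `-d²/dx²`. -/
noncomputable def psi4 (h ξ : ℝ) : ℝ :=
  ((1/6) * Real.cos (2*ξ*h) - (8/3) * Real.cos (ξ*h) + 5/2) / h^2

/-- Fourth-order discrete frequency `ξ_h = sign(ξ)·√(ψ_h^{(4)}(ξ))`. -/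
noncomputable def xiH (h ξ : ℝ) : ℝ := Real.sign ξ * Real.sqrt (psi4 h ξ)

/-- One-dimensional symbol of the tempered fractional Laplacian. -/
noncomputable def Ssym (α lam ξ : ℝ) : ℂ :=
  (-1 : ℂ) ^ ⌊α⌋ * (((lam : ℂ) + Complex.I * (ξ : ℂ)) ^ (α : ℂ)
    + ((lam : ℂ) - Complex.I * (ξ : ℂ)) ^ (α : ℂ) - 2 * (lam : ℂ) ^ (α : ℂ))

/-- Fourth-order discrete symbol of the tempered fractional Laplacian. -/
noncomputable def SsymH (α lam h ξ : ℝ) : ℂ := Ssym α lam (xiH h ξ)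

/-- Sixth-order Taylor remainder of the cosine on all of `ℝ`. -/
lemma abs_cos_sub_taylor_le (x : ℝ) :
    |Real.cos x - (1 - x ^ 2 / 2 + x ^ 4 / 24)| ≤ |x| ^ 6 * Real.exp |x| := by
  have key := Complex.norm_exp_sub_sum_le_norm_mul_exp ((x : ℂ) * I) 6
  have hre : (Complex.exp ((x : ℂ) * I)
      - ∑ m ∈ Finset.range 6, ((x : ℂ) * I) ^ m / (m.factorial : ℂ)).re
      = Real.cos x - (1 - x ^ 2 / 2 + x ^ 4 / 24) := by
    have hsum : ∑ m ∈ Finset.range 6, ((x : ℂ) * I) ^ m / (m.factorial : ℂ)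
        = ((1 - x ^ 2 / 2 + x ^ 4 / 24 : ℝ) : ℂ)
          + ((x - x ^ 3 / 6 + x ^ 5 / 120 : ℝ) : ℂ) * I := by
      have h3 : I ^ 3 = -I := Complex.I_pow_three
      have h4 : I ^ 4 = 1 := Complex.I_pow_four
      have h5 : I ^ 5 = I := by rw [pow_succ, h4, one_mul]
      simp only [Finset.sum_range_succ, Finset.sum_range_zero, mul_pow, Complex.I_sq, h3, h4, h5]
      push_cast [Nat.factorial]
      ring
    rw [hsum, Complex.sub_re, Complex.exp_ofReal_mul_I_re, Complex.add_re,
      Complex.re_ofReal_mul, Complex.ofReal_re, Complex.I_re, mul_zero, add_zero]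
  have hnorm : ‖(x : ℂ) * I‖ = |x| := by simp
  rw [hnorm] at key
  rw [← hre]
  exact (Complex.abs_re_le_norm _).trans key

/-- Consistency of the fourth-order discrete Laplacian symbol. -/
lemma abs_sq_sub_psi4_le {h ξ : ℝ} (hh : 0 < h) (hξ : 0 < ξ) (hle : ξ * h ≤ Real.pi) :
    |ξ ^ 2 - psi4 h ξ| ≤ 16 * Real.exp (2 * Real.pi) * ξ ^ 6 * h ^ 4 := by
  have hx : 0 < ξ * h := mul_pos hξ hh
  have e1 := abs_cos_sub_taylor_le (ξ * h)
  have e2 := abs_cos_sub_taylor_le (2 * ξ * h)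
  rw [abs_of_pos hx] at e1
  rw [abs_of_pos (by linarith : 0 < 2 * ξ * h)] at e2
  have m1 : Real.exp (ξ * h) ≤ Real.exp (2 * Real.pi) :=
    Real.exp_le_exp.2 (by linarith [Real.pi_pos])
  have m2 : Real.exp (2 * ξ * h) ≤ Real.exp (2 * Real.pi) := Real.exp_le_exp.2 (by linarith)
  have f1 := e1.trans (mul_le_mul_of_nonneg_left m1 (by positivity))
  have f2 := e2.trans (mul_le_mul_of_nonneg_left m2 (by positivity))
  have hpos : 0 ≤ (ξ * h) ^ 6 * Real.exp (2 * Real.pi) := by positivity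
  have hdiff : |(ξ ^ 2 - psi4 h ξ) * h ^ 2|
      ≤ 16 * ((ξ * h) ^ 6 * Real.exp (2 * Real.pi)) := by
    have hcancel : (ξ ^ 2 - psi4 h ξ) * h ^ 2 = (ξ * h) ^ 2
        - ((1/6) * Real.cos (2*ξ*h) - (8/3) * Real.cos (ξ*h) + 5/2) := by
      unfold psi4
      field_simp
    rw [hcancel]
    rw [abs_le] at f1 f2 ⊢
    constructor <;> nlinarith
  rw [abs_mul, abs_of_pos (by positivity : 0 < h ^ 2)] at hdiff
  refine le_of_mul_le_mul_right (hdiff.trans (le_of_eq ?_)) (by positivity : 0 < h ^ 2)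
  ring

lemma psi4_mul_sq {h : ℝ} (hh : 0 < h) (ξ : ℝ) :
    psi4 h ξ * h ^ 2
      = 4 * Real.sin (ξ * h / 2) ^ 2 * (1 + Real.sin (ξ * h / 2) ^ 2 / 3) := by
  have h1 : Real.cos (ξ * h) = 1 - 2 * Real.sin (ξ * h / 2) ^ 2 := by
    have := Real.cos_two_mul (ξ * h / 2)
    rw [show 2 * (ξ * h / 2) = ξ * h by ring] at this
    rw [this, Real.cos_sq']
    ring
  have h2 : Real.cos (2 * ξ * h) = 2 * Real.cos (ξ * h) ^ 2 - 1 := by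
    rw [mul_assoc, Real.cos_two_mul]
  unfold psi4
  rw [div_mul_cancel₀ _ (by positivity), h2, h1]
  ring

lemma xiH_of_pos {h ξ : ℝ} (hξ : 0 < ξ) : xiH h ξ = √(psi4 h ξ) := by
  rw [xiH, Real.sign_of_pos hξ, one_mul]

/-- The discrete frequency is comparable to the continuous one. -/
lemma xiH_mem_Icc {h ξ : ℝ} (hh : 0 < h) (hξ : 0 < ξ) (hle : ξ * h ≤ Real.pi) :
    xiH h ξ ∈ Set.Icc (ξ / 2) (2 * ξ) := by
  have hx : 0 < ξ * h := mul_pos hξ hh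
  have hlow : ξ * h / 4 ≤ Real.sin (ξ * h / 2) := by
    refine le_trans ?_ (Real.mul_le_sin (by linarith) (by linarith))
    have : 1 / 2 ≤ 2 / Real.pi := by
      rw [div_le_div_iff₀ two_pos Real.pi_pos]
      linarith [Real.pi_le_four]
    nlinarith
  have hup : Real.sin (ξ * h / 2) ≤ ξ * h / 2 := Real.sin_le (by linarith)
  have hone : Real.sin (ξ * h / 2) ^ 2 ≤ 1 := Real.sin_sq_le_one _
  have hsq_low : (ξ * h / 4) ^ 2 ≤ Real.sin (ξ * h / 2) ^ 2 :=
    pow_le_pow_left₀ (by positivity) hlow 2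
  have hsq_up : Real.sin (ξ * h / 2) ^ 2 ≤ (ξ * h / 2) ^ 2 :=
    pow_le_pow_left₀ (by linarith) hup 2
  have hpsi := psi4_mul_sq hh ξ
  have hh2 : 0 < h ^ 2 := by positivity
  rw [xiH_of_pos hξ]
  constructor
  · refine Real.le_sqrt_of_sq_le (le_of_mul_le_mul_right ?_ hh2)
    rw [hpsi]
    nlinarith [sq_nonneg (Real.sin (ξ * h / 2) ^ 2)]
  · refine Real.sqrt_le_iff.2 ⟨by positivity, le_of_mul_le_mul_right ?_ hh2⟩
    rw [hpsi]
    nlinarith [sq_nonneg (Real.sin (ξ * h / 2))]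

/-- The discrete frequency is fourth-order accurate. -/
lemma abs_sub_xiH_le {h ξ : ℝ} (hh : 0 < h) (hξ : 0 < ξ) (hle : ξ * h ≤ Real.pi) :
    |ξ - xiH h ξ| ≤ 16 * Real.exp (2 * Real.pi) * ξ ^ 5 * h ^ 4 := by
  have hη := (xiH_mem_Icc hh hξ hle).1
  have hsq : xiH h ξ ^ 2 = psi4 h ξ := by
    have hpos : 0 < √(psi4 h ξ) := by
      rw [← xiH_of_pos hξ]
      linarith
    rw [xiH_of_pos hξ, Real.sq_sqrt (Real.sqrt_pos.1 hpos).le]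
  have hbound := abs_sq_sub_psi4_le hh hξ hle
  rw [← hsq, show ξ ^ 2 - xiH h ξ ^ 2 = (ξ - xiH h ξ) * (ξ + xiH h ξ) by ring, abs_mul,
    abs_of_pos (by linarith : 0 < ξ + xiH h ξ)] at hbound
  refine le_of_mul_le_mul_right ?_ hξ
  calc |ξ - xiH h ξ| * ξ ≤ |ξ - xiH h ξ| * (ξ + xiH h ξ) :=
        mul_le_mul_of_nonneg_left (by linarith) (abs_nonneg _)
    _ ≤ _ := hbound
    _ = _ := by ring

lemma rpow_le_two_mul_rpow {r R β : ℝ} (hR : 0 < R) (hlow : R / 2 ≤ r) (hup : r ≤ 2 * R)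
    (hβ : |β| ≤ 1) : r ^ β ≤ 2 * R ^ β := by
  have hr : 0 < r := by linarith
  obtain ⟨hβ1, hβ2⟩ := abs_le.1 hβ
  rcases le_total 0 β with hβ0 | hβ0
  · calc r ^ β ≤ (2 * R) ^ β := Real.rpow_le_rpow hr.le hup hβ0
      _ = 2 ^ β * R ^ β := Real.mul_rpow two_pos.le hR.le
      _ ≤ 2 * R ^ β := by
        refine mul_le_mul_of_nonneg_right ?_ (by positivity)
        simpa using Real.rpow_le_rpow_of_exponent_le one_le_two hβ2
  · calc r ^ β ≤ (2⁻¹ * R) ^ β :=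
          Real.rpow_le_rpow_of_nonpos (by positivity) (by linarith) hβ0
      _ = 2 ^ (-β) * R ^ β := by
        rw [Real.mul_rpow (by positivity) hR.le, Real.inv_rpow two_pos.le,
          Real.rpow_neg two_pos.le]
      _ ≤ 2 * R ^ β := by
        refine mul_le_mul_of_nonneg_right ?_ (by positivity)
        simpa using Real.rpow_le_rpow_of_exponent_le one_le_two (by linarith : -β ≤ 1)

/-- Lipschitz estimate for `t ↦ (λ ± i t) ^ α` near `ξ`. -/
lemma norm_cpow_sub_cpow_le {α lam ξ η ε : ℝ} (hα : α ∈ Set.Ioo (0 : ℝ) 2)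
    (hε : ε ^ 2 = 1) (hξ : 0 < ξ) (hη : η ∈ Set.Icc (ξ / 2) (2 * ξ)) :
    ‖((lam : ℂ) + ((ε * ξ : ℝ) : ℂ) * I) ^ (α : ℂ)
        - ((lam : ℂ) + ((ε * η : ℝ) : ℂ) * I) ^ (α : ℂ)‖
      ≤ α * (2 * √(lam ^ 2 + ξ ^ 2) ^ (α - 1)) * |ξ - η| := by
  have hε0 : ε ≠ 0 := by
    rintro rfl
    norm_num at hε
  have hbase (t : ℝ) : HasDerivAt (fun t : ℝ => (lam : ℂ) + ((ε * t : ℝ) : ℂ) * I)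
      ((ε : ℂ) * I) t := by
    have := ((((hasDerivAt_id t).const_mul ε).ofReal_comp).mul_const I).const_add (lam : ℂ)
    simpa using this
  have hderiv : ∀ t ∈ Set.Icc (ξ / 2) (2 * ξ),
      HasDerivWithinAt (fun t : ℝ => ((lam : ℂ) + ((ε * t : ℝ) : ℂ) * I) ^ (α : ℂ))
        ((α : ℂ) * ((lam : ℂ) + ((ε * t : ℝ) : ℂ) * I) ^ ((α : ℂ) - 1) * ((ε : ℂ) * I))
        (Set.Icc (ξ / 2) (2 * ξ)) t := by
    intro t ht
    have ht0 : 0 < t := by linarith [ht.1]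
    have hslit : (lam : ℂ) + ((ε * t : ℝ) : ℂ) * I ∈ Complex.slitPlane := by
      refine Complex.mem_slitPlane_iff.2 (Or.inr ?_)
      simpa using ⟨hε0, ht0.ne'⟩
    have houter := (hasDerivAt_id ((lam : ℂ) + ((ε * t : ℝ) : ℂ) * I)).cpow_const
      (c := (α : ℂ)) hslit
    have := houter.comp_of_eq t (hbase t) rfl
    simpa [Function.comp_def] using this.hasDerivWithinAt
  have hbound : ∀ t ∈ Set.Icc (ξ / 2) (2 * ξ),
      ‖(α : ℂ) * ((lam : ℂ) + ((ε * t : ℝ) : ℂ) * I) ^ ((α : ℂ) - 1) * ((ε : ℂ) * I)‖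
        ≤ α * (2 * √(lam ^ 2 + ξ ^ 2) ^ (α - 1)) := by
    intro t ht
    have ht0 : 0 < t := by linarith [ht.1]
    have hεnorm : ‖(ε : ℂ) * I‖ = 1 := by
      rcases (sq_eq_sq_iff_eq_or_eq_neg.1 (hε.trans (one_pow 2).symm)) with rfl | rfl <;> simp
    have hznorm : ‖(lam : ℂ) + ((ε * t : ℝ) : ℂ) * I‖ = √(lam ^ 2 + t ^ 2) := by
      rw [Complex.norm_add_mul_I, mul_pow, hε, one_mul]
    have hcast : (α : ℂ) - 1 = ((α - 1 : ℝ) : ℂ) := by push_cast; rfl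
    rw [norm_mul, norm_mul, hεnorm, mul_one, hcast, Complex.norm_cpow_real, hznorm,
      Complex.norm_real, Real.norm_of_nonneg hα.1.le]
    refine mul_le_mul_of_nonneg_left (rpow_le_two_mul_rpow (by positivity) ?_ ?_ ?_) hα.1.le
    · refine Real.le_sqrt_of_sq_le ?_
      rw [div_pow, Real.sq_sqrt (by positivity)]
      nlinarith [ht.1, sq_nonneg lam]
    · refine Real.sqrt_le_iff.2 ⟨by positivity, ?_⟩
      rw [mul_pow, Real.sq_sqrt (by positivity)]
      nlinarith [ht.2, sq_nonneg lam]
    · rw [abs_le]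
      constructor <;> linarith [hα.1, hα.2]
  have hξmem : ξ ∈ Set.Icc (ξ / 2) (2 * ξ) := ⟨by linarith, by linarith⟩
  simpa using (convex_Icc (ξ / 2) (2 * ξ)).norm_image_sub_le_of_norm_hasDerivWithin_le
    hderiv hbound hη hξmem

lemma norm_Ssym_sub_le {α lam ξ η : ℝ} (hα : α ∈ Set.Ioo (0 : ℝ) 2) (hξ : 0 < ξ)
    (hη : η ∈ Set.Icc (ξ / 2) (2 * ξ)) :
    ‖Ssym α lam ξ - Ssym α lam η‖ ≤ 4 * α * √(lam ^ 2 + ξ ^ 2) ^ (α - 1) * |ξ - η| := by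
  have hplus := norm_cpow_sub_cpow_le (lam := lam) (ε := 1) hα (by norm_num) hξ hη
  have hminus := norm_cpow_sub_cpow_le (lam := lam) (ε := -1) hα (by norm_num) hξ hη
  have hcoe (t : ℝ) : (lam : ℂ) + I * t = lam + ((1 * t : ℝ) : ℂ) * I := by
    push_cast; ring
  have hcoe' (t : ℝ) : (lam : ℂ) - I * t = lam + ((-1 * t : ℝ) : ℂ) * I := by
    push_cast; ring
  unfold Ssym
  rw [← mul_sub, norm_mul, norm_zpow, norm_neg, norm_one, one_zpow, one_mul,
    hcoe, hcoe, hcoe', hcoe']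
  refine (le_of_eq (congrArg _ ?_)).trans
    ((norm_add_le _ _).trans ((add_le_add hplus hminus).trans (le_of_eq ?_)))
  · ring
  · ring

lemma Ssym_neg (α lam ξ : ℝ) : Ssym α lam (-ξ) = Ssym α lam ξ := by
  unfold Ssym
  push_cast
  rw [mul_neg, sub_neg_eq_add, ← sub_eq_add_neg]
  ring

lemma xiH_neg (h ξ : ℝ) : xiH h (-ξ) = -xiH h ξ := by
  have hpsi : psi4 h (-ξ) = psi4 h ξ := by
    unfold psi4
    rw [show 2 * -ξ * h = -(2 * ξ * h) by ring, neg_mul, Real.cos_neg, Real.cos_neg]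
  rw [xiH, xiH, hpsi, Real.sign_neg, neg_mul]

lemma SsymH_neg (α lam h ξ : ℝ) : SsymH α lam h (-ξ) = SsymH α lam h ξ := by
  rw [SsymH, xiH_neg, Ssym_neg, SsymH]

lemma norm_Ssym_sub_SsymH_le {α lam h ξ : ℝ} (hα : α ∈ Set.Ioo (0 : ℝ) 2) (hh : 0 < h)
    (hξ : 0 < ξ) (hle : ξ * h ≤ Real.pi) :
    ‖Ssym α lam ξ - SsymH α lam h ξ‖ ≤
      64 * Real.exp (2 * Real.pi) * α * (lam ^ 2 + ξ ^ 2) ^ ((α + 4) / 2) * h ^ 4 := by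
  set R := √(lam ^ 2 + ξ ^ 2) with hR
  have hRpos : 0 < R := by positivity
  have hξR : ξ ≤ R := Real.le_sqrt_of_sq_le (by nlinarith [sq_nonneg lam])
  have hα0 := hα.1
  have hpow : R ^ (α - 1) * R ^ 5 = (lam ^ 2 + ξ ^ 2) ^ ((α + 4) / 2) := by
    rw [← Real.rpow_natCast, ← Real.rpow_add hRpos, hR, Real.sqrt_eq_rpow,
      ← Real.rpow_mul (by positivity)]
    congr 1
    push_cast
    ring
  calc ‖Ssym α lam ξ - SsymH α lam h ξ‖
      ≤ 4 * α * R ^ (α - 1) * |ξ - xiH h ξ| := norm_Ssym_sub_le hα hξ (xiH_mem_Icc hh hξ hle)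
    _ ≤ 4 * α * R ^ (α - 1) * (16 * Real.exp (2 * Real.pi) * R ^ 5 * h ^ 4) := by
        refine mul_le_mul_of_nonneg_left ((abs_sub_xiH_le hh hξ hle).trans ?_) (by positivity)
        gcongr
    _ = 64 * Real.exp (2 * Real.pi) * α * (R ^ (α - 1) * R ^ 5) * h ^ 4 := by ring
    _ = _ := by rw [hpow]

/-- For `α ∈ (0,2)`, `α ≠ 1` there is `C > 0`, independent of `h`, `ξ` and `λ`,
such that for all `λ ≥ 0`, `h > 0` and `|ξ| ≤ π/h`,
`|S_λ^α(ξ) − S_{λ,h}^α(ξ)| ≤ C·α·(λ² + ξ²)^((α+4)/2)·h⁴`. -/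
theorem symbol_error_fourth_order (α : ℝ) (hα : α ∈ Set.Ioo (0:ℝ) 2) (hα1 : α ≠ 1) :
    ∃ C : ℝ, 0 < C ∧ ∀ lam : ℝ, 0 ≤ lam → ∀ h : ℝ, 0 < h → ∀ ξ : ℝ, |ξ| ≤ Real.pi / h →
      ‖Ssym α lam ξ - SsymH α lam h ξ‖ ≤
        C * α * (lam^2 + ξ^2) ^ ((α+4)/2) * h^4 := by
  refine ⟨64 * Real.exp (2 * Real.pi), by positivity, fun lam _ h hh ξ hξ => ?_⟩
  rw [le_div_iff₀ hh] at hξ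
  rcases lt_trichotomy ξ 0 with hneg | rfl | hpos
  · rw [abs_of_neg hneg] at hξ
    simpa [Ssym_neg, SsymH_neg] using
      norm_Ssym_sub_SsymH_le (lam := lam) hα hh (neg_pos.2 hneg) hξ
  · have hzero : SsymH α lam h 0 = Ssym α lam 0 := by simp [SsymH, xiH]
    have hα0 := hα.1
    rw [hzero, sub_self, norm_zero]
    positivity
  · rw [abs_of_pos hpos] at hξ
    exact norm_Ssym_sub_SsymH_le hα hh hpos hξ
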